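/- arXiv:2307.15844 — 3 statements merged into one kernel-verified Lean document; each statement's English description precedes it below -/
import Mathlib

section
/- Let X_1, …, X_m form a Markov chain on a tree G = (M, E). Then the shared information satisfies SI(X_M) = min over edges (i,j) ∈ E of the mutual information I(X_i ∧ X_j). -/
open Classical
open scoped BigOperators

noncomputable section

namespace MCT

variable {m : ℕ}

/-- Marginal pmf of the coordinates in `A`. -/
def marg (𝒳 : Fin m → Type) [∀ i, Fintype (𝒳 i)]
    (p : (∀ i, 𝒳 i) → ℝ) (A : Finset (Fin m)) (y : (i : A) → 𝒳 i.1) : ℝ :=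
  ∑ x : (i : Fin m) → 𝒳 i, if ∀ i : A, x i.1 = y i then p x else 0

/-- Shannon entropy (base 2) of the collection `X_A`. -/
def ent (𝒳 : Fin m → Type) [∀ i, Fintype (𝒳 i)]
    (p : (∀ i, 𝒳 i) → ℝ) (A : Finset (Fin m)) : ℝ :=
  -∑ y : (i : A) → 𝒳 i.1, marg 𝒳 p A y * Real.logb 2 (marg 𝒳 p A y)

/-- Mutual information I(X_A ∧ X_B). -/
def mutI (𝒳 : Fin m → Type) [∀ i, Fintype (𝒳 i)]
    (p : (∀ i, 𝒳 i) → ℝ) (A B : Finset (Fin m)) : ℝ :=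
  ent 𝒳 p A + ent 𝒳 p B - ent 𝒳 p (A ∪ B)

/-- Conditional mutual information I(X_A ∧ X_B | X_S). -/
def cmi (𝒳 : Fin m → Type) [∀ i, Fintype (𝒳 i)]
    (p : (∀ i, 𝒳 i) → ℝ) (A B S : Finset (Fin m)) : ℝ :=
  ent 𝒳 p (A ∪ S) + ent 𝒳 p (B ∪ S) - ent 𝒳 p (A ∪ B ∪ S) - ent 𝒳 p S

/-- `side G i j` = B(i←j): vertices connected to `j` by a path containing edge (i,j),
equivalently the vertices on `i`'s side once edge (i,j) is removed. -/
def side {V : Type*} [Fintype V] (G : SimpleGraph V) (i j : V) : Finset V :=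
  Finset.univ.filter fun k => (G.deleteEdges {s(i, j)}).Reachable k i

/-- Markov chain on a tree: for each edge (i,j), X_j ⊥ X_{B(i←j)\{i}} | X_i. -/
def IsMCT (𝒳 : Fin m → Type) [∀ i, Fintype (𝒳 i)] (G : SimpleGraph (Fin m))
    (p : (∀ i, 𝒳 i) → ℝ) : Prop :=
  ∀ i j : Fin m, G.Adj i j → cmi 𝒳 p {j} ((side G i j).erase i) {i} = 0

/-- A partition of {1,…,m} into nonempty pairwise disjoint atoms covering everything. -/
def IsPartition (π : Finset (Finset (Fin m))) : Prop :=
  (∀ a ∈ π, a.Nonempty) ∧ ((π : Set (Finset (Fin m))).PairwiseDisjoint id) ∧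
    π.sup id = Finset.univ

/-- I(π) = (1/(|π|−1))·[Σ_{a∈π} H(X_a) − H(X_M)]. -/
def cI (𝒳 : Fin m → Type) [∀ i, Fintype (𝒳 i)]
    (p : (∀ i, 𝒳 i) → ℝ) (π : Finset (Finset (Fin m))) : ℝ :=
  ((π.card : ℝ) - 1)⁻¹ * ((∑ a ∈ π, ent 𝒳 p a) - ent 𝒳 p Finset.univ)

/-- Shared information: minimum of I(π) over partitions with at least two atoms. -/
def SI (𝒳 : Fin m → Type) [∀ i, Fintype (𝒳 i)] (p : (∀ i, 𝒳 i) → ℝ) : ℝ :=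
  sInf {r | ∃ π : Finset (Finset (Fin m)), IsPartition π ∧ 2 ≤ π.card ∧ r = cI 𝒳 p π}


section Entropy

variable (𝒳 : Fin m → Type) [∀ i, Fintype (𝒳 i)] (p : (∀ i, 𝒳 i) → ℝ)

/-- Probability that the coordinates in `A` agree with those of `x`. -/
def cyl (A : Finset (Fin m)) (x : ∀ i, 𝒳 i) : ℝ :=
  ∑ y : (∀ i, 𝒳 i), if ∀ i ∈ A, y i = x i then p y else 0

theorem ent_eq_sum_log_cyl (A : Finset (Fin m)) :
    ent 𝒳 p A = -∑ x, p x * Real.logb 2 (cyl 𝒳 p A x) := by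
  have hmarg (y : (i : A) → 𝒳 i.1) (x : ∀ i, 𝒳 i) (hx : ∀ i : A, x i.1 = y i) :
      marg 𝒳 p A y = cyl 𝒳 p A x := by
    unfold marg cyl
    refine Finset.sum_congr rfl fun z _ => ?_
    congr 1
    simp only [← hx, Subtype.forall]
  have hterm (y : (i : A) → 𝒳 i.1) :
      marg 𝒳 p A y * Real.logb 2 (marg 𝒳 p A y) =
        ∑ x : (∀ i, 𝒳 i), if y = (fun i : A => x i.1) then
          p x * Real.logb 2 (cyl 𝒳 p A x) else 0 := by
    conv_lhs => enter [1]; unfold marg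
    rw [Finset.sum_mul]
    refine Finset.sum_congr rfl fun x _ => ?_
    by_cases hx : ∀ i : A, x i.1 = y i
    · rw [if_pos hx, if_pos (funext fun i => (hx i).symm), hmarg y x hx]
    · rw [if_neg hx, if_neg fun h => hx fun i => (congrFun h i).symm, zero_mul]
  unfold ent
  simp_rw [hterm]
  rw [Finset.sum_comm]
  simp

theorem ent_empty (hp1 : ∑ x, p x = 1) : ent 𝒳 p ∅ = 0 := by
  simp [ent_eq_sum_log_cyl, cyl, hp1]

variable {p}

theorem cyl_pos (hp0 : ∀ x, 0 ≤ p x) (A : Finset (Fin m)) {x : ∀ i, 𝒳 i} (hx : 0 < p x) :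
    0 < cyl 𝒳 p A x := by
  refine hx.trans_le ?_
  have := Finset.single_le_sum (f := fun y : (∀ i, 𝒳 i) => if ∀ i ∈ A, y i = x i then p y else 0)
    (fun y _ => by split_ifs <;> simp [hp0]) (Finset.mem_univ x)
  simpa [cyl] using this

theorem cyl_nonneg (hp0 : ∀ x, 0 ≤ p x) (A : Finset (Fin m)) (x : ∀ i, 𝒳 i) :
    0 ≤ cyl 𝒳 p A x :=
  Finset.sum_nonneg fun y _ => by split_ifs <;> simp [hp0]

theorem cyl_congr (A : Finset (Fin m)) {x y : ∀ i, 𝒳 i} (h : ∀ i ∈ A, x i = y i) :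
    cyl 𝒳 p A x = cyl 𝒳 p A y := by
  unfold cyl
  refine Finset.sum_congr rfl fun z _ => ?_
  congr 1
  exact propext (forall₂_congr fun i hi => by rw [h i hi])

theorem sum_fiber_div_cyl_le (hp0 : ∀ x, 0 ≤ p x) (A B : Finset (Fin m)) (y z : ∀ i, 𝒳 i) :
    ∑ x : (∀ i, 𝒳 i), (if (∀ i ∈ A, y i = x i) ∧ ∀ i ∈ B, z i = x i then
        p x / (cyl 𝒳 p (A ∪ B) x * cyl 𝒳 p (A ∩ B) x) else 0) ≤
      if ∀ i ∈ A ∩ B, z i = y i then (cyl 𝒳 p (A ∩ B) y)⁻¹ else 0 := by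
  by_cases hex : ∃ w : (∀ i, 𝒳 i), (∀ i ∈ A, y i = w i) ∧ ∀ i ∈ B, z i = w i
  · obtain ⟨w, hwA, hwB⟩ := hex
    have hyz : ∀ i ∈ A ∩ B, z i = y i := fun i hi => by
      rw [Finset.mem_inter] at hi
      rw [hwA i hi.1, hwB i hi.2]
    have hterm (x : ∀ i, 𝒳 i) : (if (∀ i ∈ A, y i = x i) ∧ ∀ i ∈ B, z i = x i then
        p x / (cyl 𝒳 p (A ∪ B) x * cyl 𝒳 p (A ∩ B) x) else 0) =
        (if ∀ i ∈ A ∪ B, x i = w i then p x else 0) *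
          ((cyl 𝒳 p (A ∪ B) w)⁻¹ * (cyl 𝒳 p (A ∩ B) y)⁻¹) := by
      by_cases hx : ∀ i ∈ A ∪ B, x i = w i
      · have hA : ∀ i ∈ A, y i = x i := fun i hi => by
          rw [hx i (Finset.mem_union_left _ hi), hwA i hi]
        have hB : ∀ i ∈ B, z i = x i := fun i hi => by
          rw [hx i (Finset.mem_union_right _ hi), hwB i hi]
        rw [if_pos ⟨hA, hB⟩, if_pos hx, cyl_congr 𝒳 (A ∪ B) hx,
          cyl_congr 𝒳 (A ∩ B) fun i hi => (hA i (Finset.mem_inter.1 hi).1).symm, div_eq_mul_inv,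
          mul_inv]
      · rw [if_neg hx, if_neg, zero_mul]
        rintro ⟨hA, hB⟩
        refine hx fun i hi => ?_
        rcases Finset.mem_union.1 hi with hi | hi
        · rw [← hA i hi, hwA i hi]
        · rw [← hB i hi, hwB i hi]
    rw [if_pos hyz, Finset.sum_congr rfl fun x _ => hterm x, ← Finset.sum_mul, ← mul_assoc]
    exact mul_le_of_le_one_left (inv_nonneg.2 (cyl_nonneg 𝒳 hp0 _ _)) mul_inv_le_one
  · rw [Finset.sum_eq_zero fun x _ => if_neg fun h => hex ⟨x, h⟩]
    split_ifs
    · exact inv_nonneg.2 (cyl_nonneg 𝒳 hp0 _ _)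
    · exact le_rfl

theorem sum_mul_cyl_ratio_le_one (hp0 : ∀ x, 0 ≤ p x) (hp1 : ∑ x, p x = 1)
    (A B : Finset (Fin m)) :
    ∑ x, p x * (cyl 𝒳 p A x * cyl 𝒳 p B x / (cyl 𝒳 p (A ∪ B) x * cyl 𝒳 p (A ∩ B) x)) ≤ 1 := by
  have hexp (x : ∀ i, 𝒳 i) :
      p x * (cyl 𝒳 p A x * cyl 𝒳 p B x / (cyl 𝒳 p (A ∪ B) x * cyl 𝒳 p (A ∩ B) x)) =
      ∑ y : (∀ i, 𝒳 i), ∑ z : (∀ i, 𝒳 i), p y * (p z *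
        if (∀ i ∈ A, y i = x i) ∧ ∀ i ∈ B, z i = x i then
          p x / (cyl 𝒳 p (A ∪ B) x * cyl 𝒳 p (A ∩ B) x) else 0) := by
    have : p x * (cyl 𝒳 p A x * cyl 𝒳 p B x / (cyl 𝒳 p (A ∪ B) x * cyl 𝒳 p (A ∩ B) x)) =
        cyl 𝒳 p A x * cyl 𝒳 p B x * (p x / (cyl 𝒳 p (A ∪ B) x * cyl 𝒳 p (A ∩ B) x)) := by ring
    rw [this]
    conv_lhs => enter [1]; unfold cyl
    rw [Finset.sum_mul_sum, Finset.sum_mul]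
    refine Finset.sum_congr rfl fun y _ => ?_
    rw [Finset.sum_mul]
    refine Finset.sum_congr rfl fun z _ => ?_
    by_cases h1 : ∀ i ∈ A, y i = x i
    · by_cases h2 : ∀ i ∈ B, z i = x i
      · rw [if_pos h1, if_pos h2, if_pos ⟨h1, h2⟩, mul_assoc]
      · rw [if_neg h2, if_neg (not_and_of_not_right _ h2)]; simp
    · rw [if_neg h1, if_neg (not_and_of_not_left _ h1)]; simp
  calc _ = ∑ y : (∀ i, 𝒳 i), ∑ z : (∀ i, 𝒳 i), p y * (p z *
        ∑ x : (∀ i, 𝒳 i), if (∀ i ∈ A, y i = x i) ∧ ∀ i ∈ B, z i = x i then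
          p x / (cyl 𝒳 p (A ∪ B) x * cyl 𝒳 p (A ∩ B) x) else 0) := by
        simp_rw [hexp, Finset.mul_sum]
        rw [Finset.sum_comm]
        exact Finset.sum_congr rfl fun y _ => Finset.sum_comm
    _ ≤ ∑ y : (∀ i, 𝒳 i), ∑ z : (∀ i, 𝒳 i), p y * (p z *
        if ∀ i ∈ A ∩ B, z i = y i then (cyl 𝒳 p (A ∩ B) y)⁻¹ else 0) :=
        Finset.sum_le_sum fun y _ => Finset.sum_le_sum fun z _ =>
          mul_le_mul_of_nonneg_left (mul_le_mul_of_nonneg_left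
            (sum_fiber_div_cyl_le 𝒳 hp0 A B y z) (hp0 z)) (hp0 y)
    _ = ∑ y : (∀ i, 𝒳 i), p y * (cyl 𝒳 p (A ∩ B) y * (cyl 𝒳 p (A ∩ B) y)⁻¹) := by
        refine Finset.sum_congr rfl fun y _ => ?_
        rw [← Finset.mul_sum]
        congr 1
        conv_rhs => enter [1]; unfold cyl
        rw [Finset.sum_mul]
        refine Finset.sum_congr rfl fun z _ => ?_
        split_ifs <;> simp
    _ ≤ ∑ y, p y := Finset.sum_le_sum fun y _ => mul_le_of_le_one_right (hp0 y) mul_inv_le_one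
    _ = 1 := hp1

/-- Entropy is submodular. -/
theorem ent_union_add_ent_inter_le (hp0 : ∀ x, 0 ≤ p x) (hp1 : ∑ x, p x = 1)
    (A B : Finset (Fin m)) :
    ent 𝒳 p (A ∪ B) + ent 𝒳 p (A ∩ B) ≤ ent 𝒳 p A + ent 𝒳 p B := by
  have hpt (x : ∀ i, 𝒳 i) :
      p x * Real.log (cyl 𝒳 p A x) + p x * Real.log (cyl 𝒳 p B x) -
        p x * Real.log (cyl 𝒳 p (A ∪ B) x) - p x * Real.log (cyl 𝒳 p (A ∩ B) x) ≤
      p x * (cyl 𝒳 p A x * cyl 𝒳 p B x / (cyl 𝒳 p (A ∪ B) x * cyl 𝒳 p (A ∩ B) x)) - p x := by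
    rcases (hp0 x).eq_or_lt with hx | hx
    · simp [← hx]
    have hA := cyl_pos 𝒳 hp0 A hx
    have hB := cyl_pos 𝒳 hp0 B hx
    have hU := cyl_pos 𝒳 hp0 (A ∪ B) hx
    have hI := cyl_pos 𝒳 hp0 (A ∩ B) hx
    have hlog := Real.log_le_sub_one_of_pos (div_pos (mul_pos hA hB) (mul_pos hU hI))
    rw [Real.log_div (mul_pos hA hB).ne' (mul_pos hU hI).ne', Real.log_mul hA.ne' hB.ne',
      Real.log_mul hU.ne' hI.ne'] at hlog
    have := mul_le_mul_of_nonneg_left hlog hx.le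
    linarith
  have hsum := Finset.sum_le_sum fun x (_ : x ∈ Finset.univ) => hpt x
  simp only [Finset.sum_sub_distrib, Finset.sum_add_distrib] at hsum
  have hratio := sum_mul_cyl_ratio_le_one 𝒳 hp0 hp1 A B
  have hent (S : Finset (Fin m)) :
      ent 𝒳 p S = -(∑ x, p x * Real.log (cyl 𝒳 p S x)) / Real.log 2 := by
    rw [ent_eq_sum_log_cyl, neg_div, Finset.sum_div]
    simp_rw [Real.logb, mul_div_assoc]
  simp only [hent]
  rw [← add_div, ← add_div]
  refine div_le_div_of_nonneg_right ?_ (Real.log_nonneg one_le_two)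
  linarith

/-- Conditioning on more coordinates decreases the conditional entropy of a coordinate. -/
theorem ent_insert_sub_le (hp0 : ∀ x, 0 ≤ p x) (hp1 : ∑ x, p x = 1)
    {S T : Finset (Fin m)} (hST : S ⊆ T) {v : Fin m} (hv : v ∉ T) :
    ent 𝒳 p (insert v T) - ent 𝒳 p T ≤ ent 𝒳 p (insert v S) - ent 𝒳 p S := by
  have h := ent_union_add_ent_inter_le 𝒳 hp0 hp1 (insert v S) T
  rw [Finset.insert_union, Finset.union_eq_right.2 hST, Finset.insert_inter_of_notMem hv,
    Finset.inter_eq_left.2 hST] at h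
  linarith

end Entropy

section Growth

variable {V : Type*}

/-- In a connected graph, a property of vertex sets that survives the addition of an adjacent
vertex extends from a nonempty set to the whole vertex set. -/
theorem prop_univ_of_grow [Fintype V] [DecidableEq V] {G : SimpleGraph V}
    (hG : G.Preconnected) (P : Finset V → Prop)
    {S : Finset V} (hS : S.Nonempty) (h0 : P S)
    (hstep : ∀ T u v, u ∈ T → v ∉ T → G.Adj u v → P T → P (insert v T)) : P Finset.univ := by
  obtain ⟨T, hT, hmax⟩ := Set.Finite.exists_maximalFor (fun T : Finset V => T.card)
    {T | T.Nonempty ∧ P T} (Set.toFinite _) ⟨S, hS, h0⟩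
  by_cases huniv : T = Finset.univ
  · exact huniv ▸ hT.2
  exfalso
  obtain ⟨x, hx⟩ := hT.1
  obtain ⟨y, hy⟩ : ∃ y, y ∉ T := by
    by_contra! h
    exact huniv (Finset.eq_univ_iff_forall.2 h)
  obtain ⟨w⟩ := hG x y
  obtain ⟨d, -, hd1, hd2⟩ := w.exists_boundary_dart (T : Set V) hx hy
  have : (insert d.snd T).card ≤ T.card := hmax (j := insert d.snd T)
    ⟨Finset.insert_nonempty _ _, hstep T d.fst d.snd hd1 hd2 d.adj hT.2⟩
    (Finset.card_le_card (Finset.subset_insert _ _))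
  rw [Finset.card_insert_of_notMem hd2] at this
  omega

/-- The edges of `G` with both endpoints in `S`. -/
def within (G : SimpleGraph V) (S : Finset V) : SimpleGraph V where
  Adj x y := G.Adj x y ∧ x ∈ S ∧ y ∈ S
  symm := ⟨fun _ _ h => ⟨h.1.symm, h.2.2, h.2.1⟩⟩
  loopless := ⟨fun _ h => h.1.ne rfl⟩

theorem within_mono (G : SimpleGraph V) {S T : Finset V} (h : S ⊆ T) : within G S ≤ within G T :=
  fun _ _ hxy => ⟨hxy.1, h hxy.2.1, h hxy.2.2⟩

theorem subset_side [Fintype V] {G : SimpleGraph V} {S : Finset V} {r u v : V}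
    (hS : ∀ x ∈ S, (within G S).Reachable x r) (hu : u ∈ S) (hv : v ∉ S) : S ⊆ side G u v := by
  intro x hx
  refine Finset.mem_filter.2 ⟨Finset.mem_univ _, ?_⟩
  refine ((hS x hx).trans (hS u hu).symm).mono fun a b hab => ?_
  rw [SimpleGraph.deleteEdges_adj]
  refine ⟨hab.1, fun h => ?_⟩
  rcases Sym2.eq_iff.1 (Set.mem_singleton_iff.1 h) with ⟨-, rfl⟩ | ⟨rfl, -⟩
  · exact hv hab.2.2
  · exact hv hab.2.1

theorem self_mem_side [Fintype V] (G : SimpleGraph V) (i j : V) : i ∈ side G i j :=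
  Finset.mem_filter.2 ⟨Finset.mem_univ _, .refl _⟩

theorem notMem_side [Fintype V] {G : SimpleGraph V} (hG : G.IsAcyclic) {i j : V} (h : G.Adj i j) :
    j ∉ side G i j := fun hj =>
  SimpleGraph.isBridge_iff.1 (SimpleGraph.isAcyclic_iff_forall_adj_isBridge.1 hG h)
    (Finset.mem_filter.1 hj).2.symm

theorem mem_side_of_adj [Fintype V] {G : SimpleGraph V} {i j u v : V} (hu : u ∈ side G i j)
    (huv : G.Adj u v) (hne : s(u, v) ≠ s(i, j)) : v ∈ side G i j := by
  refine Finset.mem_filter.2 ⟨Finset.mem_univ _, ?_⟩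
  have : (G.deleteEdges {s(i, j)}).Adj v u := by
    rw [SimpleGraph.deleteEdges_adj]
    exact ⟨huv.symm, by rwa [Sym2.eq_swap (a := v)]⟩
  exact this.reachable.trans (Finset.mem_filter.1 hu).2

theorem reachable_within_side [Fintype V] {G : SimpleGraph V} {i j x : V} (hx : x ∈ side G i j) :
    (within G (side G i j)).Reachable x i := by
  obtain ⟨w⟩ := (Finset.mem_filter.1 hx).2
  suffices h : ∀ (y z : V) (_ : (G.deleteEdges {s(i, j)}).Walk y z), z = i →
      (within G (side G i j)).Reachable y i from h x i w rfl
  intro y z w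
  induction w with
  | nil => rintro rfl; exact .refl _
  | @cons a b c hab q ih =>
    rintro rfl
    have hb : b ∈ side G c j := Finset.mem_filter.2 ⟨Finset.mem_univ _, q.reachable⟩
    have ha : a ∈ side G c j :=
      Finset.mem_filter.2 ⟨Finset.mem_univ _, hab.reachable.trans q.reachable⟩
    have : (within G (side G c j)).Adj a b := ⟨(SimpleGraph.deleteEdges_adj.1 hab).1, ha, hb⟩
    exact this.reachable.trans (ih rfl)

end Growth

section Bounds

variable (𝒳 : Fin m → Type) [∀ i, Fintype (𝒳 i)] {p : (∀ i, 𝒳 i) → ℝ}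

theorem mutI_singleton (i j : Fin m) :
    mutI 𝒳 p {i} {j} = ent 𝒳 p {i} + ent 𝒳 p {j} - ent 𝒳 p {j, i} := by
  rw [mutI, Finset.union_comm, Finset.insert_eq]

theorem sum_inter_insert {π : Finset (Finset (Fin m))} (hπ : IsPartition π)
    (g : Finset (Fin m) → ℝ) {a : Finset (Fin m)} (ha : a ∈ π) {v : Fin m} (hv : v ∈ a)
    (S : Finset (Fin m)) :
    ∑ b ∈ π, g (b ∩ insert v S) = ∑ b ∈ π, g (b ∩ S) + (g (insert v (a ∩ S)) - g (a ∩ S)) := by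
  rw [← Finset.add_sum_erase π _ ha, ← Finset.add_sum_erase π (fun b => g (b ∩ S)) ha,
    Finset.inter_insert_of_mem hv]
  have : ∑ b ∈ π.erase a, g (b ∩ insert v S) = ∑ b ∈ π.erase a, g (b ∩ S) := by
    refine Finset.sum_congr rfl fun b hb => ?_
    rw [Finset.mem_erase] at hb
    rw [Finset.inter_insert_of_notMem]
    exact Finset.disjoint_left.1 (hπ.2.1 ha hb.2 hb.1.symm) hv
  rw [this]
  ring

theorem IsPartition.exists_mem {π : Finset (Finset (Fin m))} (hπ : IsPartition π) (v : Fin m) :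
    ∃ a ∈ π, v ∈ a := by
  have : v ∈ π.sup id := hπ.2.2 ▸ Finset.mem_univ v
  simpa using this

theorem le_cI (hp0 : ∀ x, 0 ≤ p x) (hp1 : ∑ x, p x = 1) {G : SimpleGraph (Fin m)}
    (hG : G.Connected) {δ : ℝ} (hδ : ∀ i j, G.Adj i j → δ ≤ mutI 𝒳 p {i} {j})
    {π : Finset (Finset (Fin m))} (hπ : IsPartition π) (hcard : 2 ≤ π.card) :
    δ ≤ cI 𝒳 p π := by
  set g : Finset (Fin m) → ℝ := fun T => ent 𝒳 p T - if T.Nonempty then δ else 0 with hg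
  obtain ⟨r⟩ := hG.nonempty
  have key := prop_univ_of_grow hG.preconnected
    (fun S => 0 ≤ ∑ a ∈ π, g (a ∩ S) - ent 𝒳 p S + δ) (S := {r}) (Finset.singleton_nonempty r)
    (by
      obtain ⟨a, ha, hra⟩ := hπ.exists_mem r
      have := sum_inter_insert hπ g ha hra ∅
      simp only [insert_empty_eq, Finset.inter_empty] at this
      rw [this]
      simp [hg, ent_empty 𝒳 p hp1])
    (by
      intro S u v hu hv huv h
      obtain ⟨a, ha, hva⟩ := hπ.exists_mem v
      rw [sum_inter_insert hπ g ha hva]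
      by_cases hne : (a ∩ S).Nonempty
      · have := ent_insert_sub_le 𝒳 hp0 hp1 (Finset.inter_subset_right (s₁ := a) (s₂ := S)) hv
        simp only [hg, hne, Finset.insert_nonempty, if_true] at h ⊢
        linarith
      · have h1 := ent_insert_sub_le 𝒳 hp0 hp1 (Finset.singleton_subset_iff.2 hu) hv
        have h2 := hδ u v huv
        rw [mutI_singleton] at h2
        have h3 : g (insert v (a ∩ S)) - g (a ∩ S) = ent 𝒳 p {v} - δ := by
          rw [Finset.not_nonempty_iff_eq_empty.1 hne]
          simp [hg, ent_empty 𝒳 p hp1]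
        rw [h3]
        linarith)
  have hsum : ∑ a ∈ π, g (a ∩ Finset.univ) = ∑ a ∈ π, ent 𝒳 p a - π.card * δ := by
    simp only [Finset.inter_univ, hg, Finset.sum_sub_distrib]
    rw [Finset.sum_congr rfl fun a ha => if_pos (hπ.1 a ha)]
    simp
  rw [hsum] at key
  have hpos : (0 : ℝ) < π.card - 1 := by
    have : (2 : ℝ) ≤ π.card := by exact_mod_cast hcard
    linarith
  rw [cI, ← div_eq_inv_mul, le_div_iff₀ hpos]
  linarith

theorem ent_insert_side {G : SimpleGraph (Fin m)} (hMCT : IsMCT 𝒳 G p) {i j : Fin m}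
    (h : G.Adj i j) :
    ent 𝒳 p (insert j (side G i j)) - ent 𝒳 p (side G i j) = ent 𝒳 p {j, i} - ent 𝒳 p {i} := by
  have h0 := hMCT i j h
  have hs : (side G i j).erase i ∪ {i} = side G i j := by
    rw [Finset.union_comm, ← Finset.insert_eq, Finset.insert_erase (self_mem_side G i j)]
  rw [cmi, Finset.union_assoc, hs, ← Finset.insert_eq, ← Finset.insert_eq] at h0
  linarith

theorem ent_side_add_ent_compl_le (hp0 : ∀ x, 0 ≤ p x) (hp1 : ∑ x, p x = 1)
    {G : SimpleGraph (Fin m)} (hG : G.IsTree) (hMCT : IsMCT 𝒳 G p) {i j : Fin m}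
    (h : G.Adj i j) :
    ent 𝒳 p (side G i j) + ent 𝒳 p (side G i j)ᶜ - ent 𝒳 p Finset.univ ≤ mutI 𝒳 p {i} {j} := by
  set B := side G i j
  have hjB : j ∉ B := notMem_side hG.isAcyclic h
  have key := prop_univ_of_grow hG.connected.preconnected
    (fun S => insert j B ⊆ S ∧ (∀ x ∈ S, (within G S).Reachable x i) ∧
      ent 𝒳 p B + ent 𝒳 p (S \ B) - ent 𝒳 p S ≤ mutI 𝒳 p {i} {j})
    (S := insert j B) (Finset.insert_nonempty _ _)
    (by
      refine ⟨subset_rfl, fun x hx => ?_, ?_⟩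
      · have hsub := within_mono G (Finset.subset_insert j B)
        rcases Finset.mem_insert.1 hx with rfl | hx
        · exact SimpleGraph.Adj.reachable ⟨h.symm, Finset.mem_insert_self _ _,
            Finset.mem_insert_of_mem (self_mem_side G i x)⟩
        · exact (reachable_within_side hx).mono hsub
      · have := ent_insert_side 𝒳 hMCT h
        rw [Finset.insert_sdiff_of_notMem _ hjB, Finset.sdiff_self, insert_empty_eq,
          mutI_singleton]
        linarith)
    (by
      rintro S u v hu hv huv ⟨hsub, hreach, hle⟩
      have hvB : v ∉ B := fun hvB => hv (hsub (Finset.mem_insert_of_mem hvB))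
      have hvj : v ≠ j := fun hvj => hv (hsub (hvj ▸ Finset.mem_insert_self _ _))
      have huB : u ∉ B := fun huB => hvB (mem_side_of_adj huB huv fun he => by
        rcases Sym2.eq_iff.1 he with ⟨-, h2⟩ | ⟨h1, -⟩
        · exact hvj h2
        · exact hjB (h1 ▸ huB))
      refine ⟨hsub.trans (Finset.subset_insert _ _), fun x hx => ?_, ?_⟩
      · have hmono := within_mono G (Finset.subset_insert v S)
        rcases Finset.mem_insert.1 hx with rfl | hx
        · have hadj : (within G (insert x S)).Adj x u :=
            ⟨huv.symm, Finset.mem_insert_self _ _, Finset.mem_insert_of_mem hu⟩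
          exact hadj.reachable.trans ((hreach u hu).mono hmono)
        · exact (hreach x hx).mono hmono
      · have h1 := ent_insert_sub_le 𝒳 hp0 hp1 (subset_side hreach hu hv)
          (notMem_side hG.isAcyclic huv)
        have h2 := ent_insert_side 𝒳 hMCT huv
        have h3 := ent_insert_sub_le 𝒳 hp0 hp1 (S := {u}) (T := S \ B) (v := v)
          (Finset.singleton_subset_iff.2 (Finset.mem_sdiff.2 ⟨hu, huB⟩))
          fun h => hv (Finset.mem_sdiff.1 h).1
        rw [Finset.insert_sdiff_of_notMem _ hvB]
        linarith)
  rw [Finset.compl_eq_univ_sdiff]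
  exact key.2.2

theorem exists_cI_le_mutI (hp0 : ∀ x, 0 ≤ p x) (hp1 : ∑ x, p x = 1)
    {G : SimpleGraph (Fin m)} (hG : G.IsTree) (hMCT : IsMCT 𝒳 G p) {i j : Fin m}
    (h : G.Adj i j) :
    ∃ π : Finset (Finset (Fin m)), IsPartition π ∧ 2 ≤ π.card ∧ cI 𝒳 p π ≤ mutI 𝒳 p {i} {j} := by
  have hi : i ∈ side G i j := self_mem_side G i j
  have hj : j ∈ (side G i j)ᶜ := Finset.mem_compl.2 (notMem_side hG.isAcyclic h)
  have hne : side G i j ≠ (side G i j)ᶜ := fun he => Finset.mem_compl.1 (he ▸ hi) hi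
  have hcard := Finset.card_pair hne
  refine ⟨{side G i j, (side G i j)ᶜ}, ⟨?_, ?_, ?_⟩, hcard.ge, ?_⟩
  · intro a ha
    rcases Finset.mem_insert.1 ha with rfl | ha
    · exact ⟨i, hi⟩
    · rw [Finset.mem_singleton.1 ha]
      exact ⟨j, hj⟩
  · rw [Finset.coe_pair]
    exact Set.pairwise_pair.2 fun _ => ⟨disjoint_compl_right, disjoint_compl_left⟩
  · simp
  · have := ent_side_add_ent_compl_le 𝒳 hp0 hp1 hG hMCT h
    rw [cI, hcard, Finset.sum_pair hne]
    norm_num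
    linarith

end Bounds

/-- For a Markov chain on a tree `G`, the shared information equals the
minimum, over edges (i,j) of `G`, of the mutual information I(X_i ∧ X_j). -/
theorem sharedInformation_eq_min_edge_mutualInformation
    {m : ℕ} (hm : 2 ≤ m) (𝒳 : Fin m → Type) [∀ i, Fintype (𝒳 i)]
    (p : (∀ i, 𝒳 i) → ℝ) (hp0 : ∀ x, 0 ≤ p x) (hp1 : ∑ x, p x = 1)
    (G : SimpleGraph (Fin m)) (hG : G.IsTree) (hMCT : IsMCT 𝒳 G p) :
    SI 𝒳 p = sInf {r | ∃ i j : Fin m, G.Adj i j ∧ r = mutI 𝒳 p {i} {j}} := by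
  have : Nontrivial (Fin m) := Fin.nontrivial_iff_two_le.2 hm
  obtain ⟨i₀, j₀, h₀⟩ : ∃ i j, G.Adj i j := by
    obtain ⟨i⟩ := hG.connected.nonempty
    obtain ⟨j, hj⟩ := hG.connected.preconnected.exists_adj_of_nontrivial i
    exact ⟨i, j, hj⟩
  have hbdd : BddBelow {r | ∃ i j : Fin m, G.Adj i j ∧ r = mutI 𝒳 p {i} {j}} := by
    refine ((Set.finite_range fun e : Fin m × Fin m => mutI 𝒳 p {e.1} {e.2}).subset ?_).bddBelow
    rintro _ ⟨i, j, -, rfl⟩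
    exact ⟨(i, j), rfl⟩
  have hlower : ∀ r ∈ {r | ∃ π : Finset (Finset (Fin m)), IsPartition π ∧ 2 ≤ π.card ∧
      r = cI 𝒳 p π}, sInf {r | ∃ i j : Fin m, G.Adj i j ∧ r = mutI 𝒳 p {i} {j}} ≤ r := by
    rintro _ ⟨π, hπ, hcard, rfl⟩
    exact le_cI 𝒳 hp0 hp1 hG.connected (fun i j h => csInf_le hbdd ⟨i, j, h, rfl⟩) hπ hcard
  apply le_antisymm
  · refine le_csInf ⟨_, i₀, j₀, h₀, rfl⟩ ?_
    rintro _ ⟨i, j, h, rfl⟩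
    obtain ⟨π, hπ, hcard, hle⟩ := exists_cI_le_mutI 𝒳 hp0 hp1 hG hMCT h
    exact (csInf_le ⟨_, hlower⟩ ⟨π, hπ, hcard, rfl⟩).trans hle
  · obtain ⟨π, hπ, hcard, -⟩ := exists_cI_le_mutI 𝒳 hp0 hp1 hG hMCT h₀
    exact le_csInf ⟨_, π, hπ, hcard, rfl⟩ hlower

end MCT
end
end

section
/- Let X_1, …, X_m form a Markov chain on a tree G = (M, E). Then SI(X_M) ≤ min over edges (i,j) ∈ E of I(X_i ∧ X_j); more precisely, for each edge (i,j) ∈ E, the 2-partition π = (B(i←j), B(j←i)) of M satisfies I(π) = I(X_{B(i←j)} ∧ X_{B(j←i)}) = I(X_i ∧ X_j), and hence SI(X_M) ≤ I(X_i ∧ X_j). -/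
open Classical
open scoped BigOperators

noncomputable section

namespace MCT

variable {m : ℕ}

section Entropy

variable (𝒳 : Fin m → Type) [∀ i, Fintype (𝒳 i)] (p : (∀ i, 𝒳 i) → ℝ)

/-- The probability that the coordinates in `A` agree with those of `x`. -/
def agreeProb (A : Finset (Fin m)) (x : ∀ i, 𝒳 i) : ℝ :=
  ∑ x', if ∀ i ∈ A, x' i = x i then p x' else 0

theorem ent_eq_sum_agreeProb (A : Finset (Fin m)) :
    ent 𝒳 p A = -∑ x, p x * Real.logb 2 (agreeProb 𝒳 p A x) := by
  have hmarg : ∀ x : ∀ i, 𝒳 i, marg 𝒳 p A (fun i => x i.1) = agreeProb 𝒳 p A x := by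
    intro x
    simp [marg, agreeProb]
  unfold ent
  congr 1
  calc ∑ y : (i : A) → 𝒳 i.1, marg 𝒳 p A y * Real.logb 2 (marg 𝒳 p A y)
      = ∑ y : (i : A) → 𝒳 i.1, ∑ x : ∀ i, 𝒳 i,
          if y = (fun i : A => x i.1) then p x * Real.logb 2 (marg 𝒳 p A y) else 0 := by
        refine Finset.sum_congr rfl fun y _ => ?_
        conv_lhs => enter [1]; rw [marg]
        rw [Finset.sum_mul]
        refine Finset.sum_congr rfl fun x _ => ?_
        by_cases h : y = fun i : A => x i.1
        · subst h; simp
        · rw [if_neg h, if_neg, zero_mul]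
          exact fun h' => h (funext fun i => (h' i).symm)
    _ = _ := by
        rw [Finset.sum_comm]
        refine Finset.sum_congr rfl fun x _ => ?_
        rw [Finset.sum_ite_eq' Finset.univ, if_pos (Finset.mem_univ _), hmarg]

variable {p}

theorem agreeProb_nonneg (hp0 : ∀ x, 0 ≤ p x) (A : Finset (Fin m)) (x : ∀ i, 𝒳 i) :
    0 ≤ agreeProb 𝒳 p A x :=
  Finset.sum_nonneg fun x' _ => by split_ifs <;> simp [hp0]

theorem le_agreeProb (hp0 : ∀ x, 0 ≤ p x) (A : Finset (Fin m)) (x : ∀ i, 𝒳 i) :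
    p x ≤ agreeProb 𝒳 p A x := by
  have h := Finset.single_le_sum (s := Finset.univ)
    (f := fun x' => if ∀ i ∈ A, x' i = x i then p x' else 0)
    (fun x' _ => by split_ifs <;> simp [hp0]) (Finset.mem_univ x)
  simpa [agreeProb] using h

theorem agreeProb_congr {A : Finset (Fin m)} {x y : ∀ i, 𝒳 i} (h : ∀ i ∈ A, x i = y i) :
    agreeProb 𝒳 p A x = agreeProb 𝒳 p A y := by
  unfold agreeProb
  refine Finset.sum_congr rfl fun z _ => ?_
  have : (∀ i ∈ A, z i = x i) ↔ (∀ i ∈ A, z i = y i) :=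
    forall₂_congr fun i hi => by rw [h i hi]
  simp only [this]

/-- The conditional product kernel `P(x_A) P(x_B) / P(x_{A ∩ B})` is a sub-probability on
the support of `X_{A ∪ B}`. -/
theorem sum_agreeProb_ratio_le_one (hp0 : ∀ x, 0 ≤ p x) (hp1 : ∑ x, p x = 1)
    (A B : Finset (Fin m)) :
    ∑ x, p x * (agreeProb 𝒳 p A x * agreeProb 𝒳 p B x /
      (agreeProb 𝒳 p (A ∪ B) x * agreeProb 𝒳 p (A ∩ B) x)) ≤ 1 := by
  have hinner : ∀ a b : ∀ i, 𝒳 i,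
      ∑ x, (if (∀ i ∈ A, a i = x i) ∧ (∀ i ∈ B, b i = x i) then
        p x / (agreeProb 𝒳 p (A ∪ B) x * agreeProb 𝒳 p (A ∩ B) x) else 0) ≤
      if ∀ i ∈ A ∩ B, b i = a i then (agreeProb 𝒳 p (A ∩ B) a)⁻¹ else 0 := by
    intro a b
    by_cases hex : ∃ x : ∀ i, 𝒳 i, (∀ i ∈ A, a i = x i) ∧ (∀ i ∈ B, b i = x i)
    · obtain ⟨c, hca, hcb⟩ := hex
      rw [if_pos fun i hi => by
        rw [hca i (Finset.mem_inter.1 hi).1, hcb i (Finset.mem_inter.1 hi).2]]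
      have hterm : ∀ x : ∀ i, 𝒳 i, (if (∀ i ∈ A, a i = x i) ∧ (∀ i ∈ B, b i = x i) then
          p x / (agreeProb 𝒳 p (A ∪ B) x * agreeProb 𝒳 p (A ∩ B) x) else 0) =
          (if ∀ i ∈ A ∪ B, x i = c i then p x else 0) *
            ((agreeProb 𝒳 p (A ∪ B) c)⁻¹ * (agreeProb 𝒳 p (A ∩ B) a)⁻¹) := by
        intro x
        by_cases hx : ∀ i ∈ A ∪ B, x i = c i
        · have hxa : ∀ i ∈ A, a i = x i := fun i hi => by
            rw [hx i (Finset.mem_union_left _ hi), hca i hi]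
          have hxb : ∀ i ∈ B, b i = x i := fun i hi => by
            rw [hx i (Finset.mem_union_right _ hi), hcb i hi]
          rw [if_pos ⟨hxa, hxb⟩, if_pos hx, agreeProb_congr 𝒳 hx,
            agreeProb_congr 𝒳 (A := A ∩ B) (x := x) (y := a) fun i hi =>
              (hxa i (Finset.mem_inter.1 hi).1).symm, div_eq_mul_inv, mul_inv]
        · rw [if_neg hx, zero_mul, if_neg]
          rintro ⟨hxa, hxb⟩
          refine hx fun i hi => ?_
          rcases Finset.mem_union.1 hi with h | h
          · rw [← hxa i h, hca i h]
          · rw [← hxb i h, hcb i h]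
      rw [Finset.sum_congr rfl fun x _ => hterm x, ← Finset.sum_mul]
      change agreeProb 𝒳 p (A ∪ B) c * _ ≤ _
      rw [← mul_assoc]
      exact mul_le_of_le_one_left (inv_nonneg.2 (agreeProb_nonneg 𝒳 hp0 _ _))
        mul_inv_le_one
    · push Not at hex
      rw [Finset.sum_eq_zero fun x _ => if_neg fun h => by
        obtain ⟨i, hi, hne⟩ := hex x h.1
        exact hne (h.2 i hi)]
      split_ifs
      · exact inv_nonneg.2 (agreeProb_nonneg 𝒳 hp0 _ _)
      · exact le_rfl
  calc _ = ∑ a, ∑ b, p a * p b *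
        ∑ x, (if (∀ i ∈ A, a i = x i) ∧ (∀ i ∈ B, b i = x i) then
          p x / (agreeProb 𝒳 p (A ∪ B) x * agreeProb 𝒳 p (A ∩ B) x) else 0) := by
        simp_rw [Finset.mul_sum]
        rw [Finset.sum_congr rfl fun a _ => Finset.sum_comm, Finset.sum_comm]
        refine Finset.sum_congr rfl fun x _ => ?_
        have : agreeProb 𝒳 p A x * agreeProb 𝒳 p B x = ∑ a, ∑ b,
            (if ∀ i ∈ A, a i = x i then p a else 0) *
              (if ∀ i ∈ B, b i = x i then p b else 0) := by
          rw [agreeProb, agreeProb, Finset.sum_mul_sum]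
        rw [this, Finset.sum_div, Finset.mul_sum]
        refine Finset.sum_congr rfl fun a _ => ?_
        rw [Finset.sum_div, Finset.mul_sum]
        refine Finset.sum_congr rfl fun b _ => ?_
        by_cases h1 : ∀ i ∈ A, a i = x i
        · by_cases h2 : ∀ i ∈ B, b i = x i
          · rw [if_pos h1, if_pos h2, if_pos ⟨h1, h2⟩]; ring
          · rw [if_neg h2, if_neg (mt And.right h2)]; simp
        · rw [if_neg h1, if_neg (mt And.left h1)]; simp
    _ ≤ ∑ a, ∑ b, p a * p b *
        (if ∀ i ∈ A ∩ B, b i = a i then (agreeProb 𝒳 p (A ∩ B) a)⁻¹ else 0) :=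
        Finset.sum_le_sum fun a _ => Finset.sum_le_sum fun b _ =>
          mul_le_mul_of_nonneg_left (hinner a b) (mul_nonneg (hp0 a) (hp0 b))
    _ = ∑ a, p a * (agreeProb 𝒳 p (A ∩ B) a * (agreeProb 𝒳 p (A ∩ B) a)⁻¹) := by
        refine Finset.sum_congr rfl fun a _ => ?_
        conv_rhs => enter [2, 1]; rw [agreeProb]
        rw [Finset.sum_mul, Finset.mul_sum]
        refine Finset.sum_congr rfl fun b _ => ?_
        split_ifs <;> ring
    _ ≤ ∑ a, p a := Finset.sum_le_sum fun a _ =>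
        mul_le_of_le_one_right (hp0 a) mul_inv_le_one
    _ = 1 := hp1

end Entropy

section Graph

variable {V : Type*} (G : SimpleGraph V)

/-- Any two vertices of `T` are joined by a path of `G` staying inside `T`. -/
def ConnectedWithin (T : Set V) : Prop :=
  ∀ s ∈ T, ∀ t ∈ T, Relation.ReflTransGen (fun a b => G.Adj a b ∧ a ∈ T ∧ b ∈ T) s t

variable {G}

theorem connectedWithin_of_forall_reaches {T : Set V} (r : V)
    (h : ∀ s ∈ T, Relation.ReflTransGen (fun a b => G.Adj a b ∧ a ∈ T ∧ b ∈ T) s r) :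
    ConnectedWithin G T := by
  intro s hs t ht
  have : Std.Symm (fun a b => G.Adj a b ∧ a ∈ T ∧ b ∈ T) :=
    ⟨fun a b hab => ⟨hab.1.symm, hab.2.2, hab.2.1⟩⟩
  exact (h s hs).trans (Std.Symm.symm _ _ (h t ht))

theorem connectedWithin_singleton (v : V) : ConnectedWithin G {v} := by
  rintro s rfl t rfl
  exact .refl

theorem ConnectedWithin.insert {T : Set V} (hT : ConnectedWithin G T) {u k : V}
    (hu : u ∈ T) (huk : G.Adj u k) : ConnectedWithin G (insert k T) := by
  refine connectedWithin_of_forall_reaches u fun s hs => ?_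
  rcases hs with rfl | hs
  · exact .single ⟨huk.symm, .inl rfl, .inr hu⟩
  · exact Relation.ReflTransGen.mono (fun a b h => ⟨h.1, .inr h.2.1, .inr h.2.2⟩) _ _ (hT s hs u hu)

/-- A proper nonempty subset of a connected vertex set has an edge leaving it. -/
theorem ConnectedWithin.exists_adj_of_ssubset {T S : Set V} (hT : ConnectedWithin G T)
    (hST : S ⊆ T) (hne : S.Nonempty) (hTS : ¬ T ⊆ S) :
    ∃ u ∈ S, ∃ k ∈ T, k ∉ S ∧ G.Adj u k := by
  by_contra! hno
  obtain ⟨s, hs⟩ := hne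
  refine hTS fun t ht => ?_
  induction hT s (hST hs) t ht with
  | refl => exact hs
  | @tail b c _ hbc ih =>
    by_contra hc
    exact hno b (ih hbc.2.1) c hbc.2.2 hc hbc.1

variable [Fintype V]

theorem ConnectedWithin.subset_side {T : Set V} (hT : ConnectedWithin G T) {u k : V}
    (hu : u ∈ T) (hk : k ∉ T) : T ⊆ side G u k := by
  intro s hs
  simp only [side, Finset.coe_filter, Finset.mem_univ, true_and, Set.mem_ofPred_eq]
  rw [SimpleGraph.reachable_iff_reflTransGen]
  refine Relation.ReflTransGen.mono (fun a b h => ?_) _ _ (hT s hs u hu)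
  rw [SimpleGraph.deleteEdges_adj]
  refine ⟨h.1, fun he => ?_⟩
  rcases Sym2.eq_iff.1 (Set.mem_singleton_iff.1 he) with ⟨-, rfl⟩ | ⟨rfl, -⟩
  · exact hk h.2.2
  · exact hk h.2.1

theorem mem_side_self (i j : V) : i ∈ side G i j := by
  simp [side]

theorem connectedWithin_side (i j : V) : ConnectedWithin G (side G i j : Set V) := by
  refine connectedWithin_of_forall_reaches i fun s hs => ?_
  have hs' : (G.deleteEdges {s(i, j)}).Reachable s i := by simpa [side] using hs
  rw [SimpleGraph.reachable_iff_reflTransGen] at hs'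
  induction hs' using Relation.ReflTransGen.head_induction_on with
  | refl => exact .refl
  | @head a c hac hci ih =>
    have hc : c ∈ (side G i j : Set V) := by
      simpa [side] using (SimpleGraph.reachable_iff_reflTransGen _ _).2 hci
    exact (ih hc).head ⟨(SimpleGraph.deleteEdges_adj.1 hac).1, hs, hc⟩

theorem side_union_side [DecidableEq V] (hG : G.Connected) (i j : V) :
    side G i j ∪ side G j i = Finset.univ := by
  refine Finset.eq_univ_of_forall fun k => ?_
  simp only [side, Finset.mem_union, Finset.mem_filter, Finset.mem_univ, true_and,
    Sym2.eq_swap (a := j) (b := i)]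
  induction (SimpleGraph.reachable_iff_reflTransGen k i).1 (hG.preconnected k i) using
    Relation.ReflTransGen.head_induction_on with
  | refl => exact .inl .rfl
  | @head a c hac _ ih =>
    by_cases he : s(a, c) = s(i, j)
    · rcases Sym2.eq_iff.1 he with ⟨rfl, -⟩ | ⟨rfl, -⟩
      · exact .inl .rfl
      · exact .inr .rfl
    · have hadj : (G.deleteEdges {s(i, j)}).Reachable a c :=
        (SimpleGraph.deleteEdges_adj.2 ⟨hac, he⟩ : (G.deleteEdges {s(i, j)}).Adj a c).reachable
      exact ih.imp hadj.trans hadj.trans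

theorem disjoint_side_side (hG : G.IsAcyclic) {i j : V} (hij : G.Adj i j) :
    Disjoint (side G i j) (side G j i) := by
  rw [Finset.disjoint_left]
  simp only [side, Finset.mem_filter, Finset.mem_univ, true_and,
    Sym2.eq_swap (a := j) (b := i)]
  exact fun k hi hj => SimpleGraph.isBridge_iff.1
    (SimpleGraph.isAcyclic_iff_forall_adj_isBridge.1 hG hij) (hi.symm.trans hj)

end Graph

section MarkovChain

variable {𝒳 : Fin m → Type} [∀ i, Fintype (𝒳 i)] {p : (∀ i, 𝒳 i) → ℝ}
  {G : SimpleGraph (Fin m)}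

/-- Adjoining a neighbour `k` of `u ∈ T` to a connected set `T` increases the entropy by
`H(X_k | X_u)`. -/
theorem IsMCT.ent_insert (hp0 : ∀ x, 0 ≤ p x) (hp1 : ∑ x, p x = 1) (hG : G.IsAcyclic)
    (hMCT : IsMCT 𝒳 G p) {T : Finset (Fin m)} (hT : ConnectedWithin G (T : Set (Fin m))) {u k : Fin m}
    (hu : u ∈ T) (hk : k ∉ T) (huk : G.Adj u k) :
    ent 𝒳 p (insert k T) = ent 𝒳 p T + ent 𝒳 p {k, u} - ent 𝒳 p {u} := by
  have hTD : T ⊆ side G u k := fun s hs =>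
    Finset.mem_coe.1 (hT.subset_side (Finset.mem_coe.2 hu) (by simpa using hk)
      (Finset.mem_coe.2 hs))
  have hmarkov := hMCT u k huk
  have huD := mem_side_self (G := G) u k
  have hD : (side G u k).erase u ∪ {u} = side G u k := by
    ext a; by_cases a = u <;> simp_all
  rw [cmi, Finset.union_assoc, hD, ← Finset.insert_eq, ← Finset.insert_eq] at hmarkov
  have hupper := ent_union_add_ent_inter_le 𝒳 hp0 hp1 T {k, u}
  have hlower := ent_union_add_ent_inter_le 𝒳 hp0 hp1 (insert k T) (side G u k)
  have hunion : T ∪ {k, u} = insert k T := by ext a; simp; grind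
  have hinter : T ∩ {k, u} = {u} := by ext a; simp; grind
  have hunion' : insert k T ∪ side G u k = insert k (side G u k) := by
    rw [Finset.insert_union, Finset.union_eq_right.2 hTD]
  rw [hunion, hinter] at hupper
  have hkD : k ∉ side G u k :=
    Finset.disjoint_right.1 (disjoint_side_side hG huk) (mem_side_self k u)
  have hinter' : insert k T ∩ side G u k = T := by
    rw [Finset.insert_inter_of_notMem hkD, Finset.inter_eq_left.2 hTD]
  rw [hunion', hinter'] at hlower
  linarith

/-- Enlarging `{i}` to a connected set `A` preserves its mutual information with a disjoint set
`C` that is attached to `i`. -/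
theorem IsMCT.mutI_eq_mutI_singleton (hp0 : ∀ x, 0 ≤ p x) (hp1 : ∑ x, p x = 1)
    (hG : G.IsAcyclic) (hMCT : IsMCT 𝒳 G p) {A C : Finset (Fin m)} {i : Fin m}
    (hA : ConnectedWithin G (A : Set (Fin m))) (hi : i ∈ A) (hAC : Disjoint A C)
    (hC : ConnectedWithin G (({i} ∪ C : Finset (Fin m)) : Set (Fin m))) :
    mutI 𝒳 p A C = mutI 𝒳 p {i} C := by
  suffices h : ∀ n : ℕ, ∀ S : Finset (Fin m), S ⊆ A → i ∈ S → (A \ S).card = n →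
      ConnectedWithin G (S : Set (Fin m)) →
      ConnectedWithin G ((S ∪ C : Finset (Fin m)) : Set (Fin m)) →
      mutI 𝒳 p A C = mutI 𝒳 p S C from
    h _ {i} (by simpa using hi) (by simp) rfl
      (by simpa using connectedWithin_singleton (G := G) i) hC
  intro n
  induction n with
  | zero =>
    intro S hSA _ hcard _ _
    rw [hSA.antisymm (Finset.sdiff_eq_empty_iff_subset.1 (Finset.card_eq_zero.1 hcard))]
  | succ n ih =>
    intro S hSA hiS hcard hS hSC
    have hAS : ¬ A ⊆ S := fun h => by
      rw [Finset.sdiff_eq_empty_iff_subset.2 h] at hcard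
      simp at hcard
    obtain ⟨u, hu, k, hkA, hkS, huk⟩ := hA.exists_adj_of_ssubset (S := (S : Set (Fin m)))
      (by exact_mod_cast hSA) ⟨i, hiS⟩ (by exact_mod_cast hAS)
    rw [Finset.mem_coe] at hu hkA hkS
    have hkSC : k ∉ S ∪ C := fun h =>
      (Finset.mem_union.1 h).elim hkS (Finset.disjoint_left.1 hAC hkA)
    have huSC : u ∈ S ∪ C := Finset.mem_union_left _ hu
    have hcard' : (A \ insert k S).card = n := by
      rw [Finset.sdiff_insert, Finset.card_erase_of_mem (Finset.mem_sdiff.2 ⟨hkA, hkS⟩), hcard]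
      rfl
    rw [ih (insert k S) (Finset.insert_subset hkA hSA) (Finset.mem_insert_of_mem hiS) hcard'
      (by rw [Finset.coe_insert]; exact hS.insert hu huk)
      (by rw [Finset.insert_union, Finset.coe_insert]; exact hSC.insert huSC huk)]
    rw [mutI, mutI, Finset.insert_union, hMCT.ent_insert hp0 hp1 hG hS hu hkS huk,
      hMCT.ent_insert hp0 hp1 hG hSC huSC hkSC huk]
    ring

theorem mutI_comm (A B : Finset (Fin m)) : mutI 𝒳 p A B = mutI 𝒳 p B A := by
  rw [mutI, mutI, Finset.union_comm]
  ring

theorem SI_le_cI {π : Finset (Finset (Fin m))} (hπ : IsPartition π) (hcard : 2 ≤ π.card) :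
    SI 𝒳 p ≤ cI 𝒳 p π := by
  refine csInf_le (Set.Finite.bddBelow ?_) ⟨π, hπ, hcard, rfl⟩
  refine (Set.finite_range fun π => cI 𝒳 p π).subset ?_
  rintro r ⟨π', -, -, rfl⟩
  exact ⟨π', rfl⟩

end MarkovChain

/-- For each edge (i,j) of an MCT, the 2-partition (B(i←j), B(j←i)) has
I(π) = I(X_B(i←j) ∧ X_B(j←i)) = I(X_i ∧ X_j), hence SI(X_M) ≤ I(X_i ∧ X_j) for every edge,
i.e. SI is at most the minimum mutual information over the edges. -/
theorem sharedInformation_le_edge_mutualInformation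
    {m : ℕ} (hm : 2 ≤ m) (𝒳 : Fin m → Type) [∀ i, Fintype (𝒳 i)]
    (p : (∀ i, 𝒳 i) → ℝ) (hp0 : ∀ x, 0 ≤ p x) (hp1 : ∑ x, p x = 1)
    (G : SimpleGraph (Fin m)) (hG : G.IsTree) (hMCT : IsMCT 𝒳 G p) :
    ∀ i j : Fin m, G.Adj i j →
      cI 𝒳 p {side G i j, side G j i} = mutI 𝒳 p (side G i j) (side G j i) ∧
      mutI 𝒳 p (side G i j) (side G j i) = mutI 𝒳 p {i} {j} ∧
      SI 𝒳 p ≤ mutI 𝒳 p {i} {j} := by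
  intro i j hij
  have hi := mem_side_self (G := G) i j
  have hj := mem_side_self (G := G) j i
  have hdisj := disjoint_side_side hG.isAcyclic hij
  have hunion := side_union_side hG.connected i j
  have hne : side G i j ≠ side G j i := fun h =>
    Finset.disjoint_left.1 hdisj hi (h ▸ hi)
  have hcard : ({side G i j, side G j i} : Finset (Finset (Fin m))).card = 2 :=
    Finset.card_pair hne
  have hcI : cI 𝒳 p {side G i j, side G j i} = mutI 𝒳 p (side G i j) (side G j i) := by
    rw [cI, mutI, hcard, Finset.sum_pair hne, hunion]
    norm_num
  have hmut : mutI 𝒳 p (side G i j) (side G j i) = mutI 𝒳 p {i} {j} := by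
    rw [hMCT.mutI_eq_mutI_singleton hp0 hp1 hG.isAcyclic (connectedWithin_side i j) hi hdisj,
      mutI_comm, hMCT.mutI_eq_mutI_singleton hp0 hp1 hG.isAcyclic (connectedWithin_side j i) hj,
      mutI_comm]
    · exact Finset.disjoint_singleton_right.2 (Finset.disjoint_left.1 hdisj hi)
    · simpa using (connectedWithin_singleton (G := G) i).insert rfl hij
    · rw [← Finset.insert_eq, Finset.coe_insert]
      exact (connectedWithin_side j i).insert (Finset.mem_coe.2 hj) hij.symm
  refine ⟨hcI, hmut, ?_⟩
  rw [← hmut, ← hcI]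
  refine SI_le_cI ⟨?_, ?_, ?_⟩ hcard.ge
  · intro a ha
    rcases Finset.mem_insert.1 ha with rfl | ha
    · exact ⟨i, hi⟩
    · rw [Finset.mem_singleton.1 ha]
      exact ⟨j, hj⟩
  · rw [Finset.coe_pair]
    exact Set.pairwise_pair.2 fun _ => ⟨hdisj, hdisj.symm⟩
  · simpa using hunion

end MCT
end
end

section
/- Let (X_t, Y_t)_{t=1}^n be n i.i.d. samples from a pmf P_{XY} with full support on the finite set 𝒳 × 𝒴. Then the bias of the empirical mutual information estimator satisfies −log((1 + (|𝒳|−1)/n)(1 + (|𝒴|−1)/n)) ≤ E[I_EMI^{(n)}(X ∧ Y)] − I(X ∧ Y) ≤ log(1 + (|𝒳||𝒴|−1)/n). -/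
open Classical
open scoped BigOperators

noncomputable section

namespace EMI

/-- Empirical distribution (type) of a length-`n` sample sequence. -/
def empDist {n : ℕ} {α : Type*} [Fintype α] (s : Fin n → α) (a : α) : ℝ :=
  ((Finset.univ.filter fun t => s t = a).card : ℝ) / n

/-- Shannon entropy (base 2) of a pmf on a finite type. -/
def ent {α : Type*} [Fintype α] (q : α → ℝ) : ℝ :=
  -∑ a, q a * Real.logb 2 (q a)

/-- Empirical mutual information `I_EMI^{(n)}` computed from `n` paired samples:
entropy of the two marginal types minus entropy of the joint type. -/
def emi {n : ℕ} {𝒳 𝒴 : Type*} [Fintype 𝒳] [Fintype 𝒴] (s : Fin n → 𝒳 × 𝒴) : ℝ :=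
  ent (empDist fun t => (s t).1) + ent (empDist fun t => (s t).2) - ent (empDist s)

/-- Mutual information I(X ∧ Y) of a joint pmf on a product of finite types. -/
def miDist {𝒳 𝒴 : Type*} [Fintype 𝒳] [Fintype 𝒴] (p : 𝒳 × 𝒴 → ℝ) : ℝ :=
  ent (fun a => ∑ b, p (a, b)) + ent (fun b => ∑ a, p (a, b)) - ent p

/-- The i.i.d. product pmf of `n` samples from `p`. -/
def prodP {n : ℕ} {α : Type*} [Fintype α] (p : α → ℝ) (ω : Fin n → α) : ℝ :=
  ∏ t, p (ω t)

/-- Expectation with respect to a pmf `P` on a finite sample space. -/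
def expect {Ω : Type*} [Fintype Ω] (P : Ω → ℝ) (f : Ω → ℝ) : ℝ := ∑ ω, P ω * f ω

/-- Probability of an event with respect to a pmf `P` on a finite sample space. -/
def probEvent {Ω : Type*} [Fintype Ω] (P : Ω → ℝ) (s : Ω → Prop) : ℝ :=
  ∑ ω, if s ω then P ω else 0


theorem sum_prodP_mul_prod {n : ℕ} {β : Type*} [Fintype β] (p : β → ℝ) (h : Fin n → β → ℝ) :
    ∑ ω : Fin n → β, prodP p ω * ∏ t, h t (ω t) = ∏ t, ∑ b, p b * h t b := by
  simp only [prodP, ← Finset.prod_mul_distrib]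
  rw [Finset.prod_univ_sum, Fintype.piFinset_univ]

theorem sum_prodP {n : ℕ} {β : Type*} [Fintype β] {p : β → ℝ} (hp : ∑ b, p b = 1) :
    ∑ ω : Fin n → β, prodP p ω = 1 := by
  simpa [hp] using sum_prodP_mul_prod (n := n) p fun _ _ => 1

theorem sum_prodP_mul_apply {n : ℕ} {β : Type*} [Fintype β] {p : β → ℝ} (hp : ∑ b, p b = 1)
    (g : β → ℝ) (t : Fin n) :
    ∑ ω : Fin n → β, prodP p ω * g (ω t) = ∑ b, p b * g b := by
  have h := sum_prodP_mul_prod (n := n) p fun r b => if r = t then g b else 1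
  have h2 : ∀ r : Fin n, ∑ b, p b * (if r = t then g b else 1) =
      if r = t then ∑ b, p b * g b else 1 := by
    intro r
    split_ifs <;> simp [hp]
  simp only [h2] at h
  simpa using h

theorem sum_prodP_mul_apply_mul_apply {n : ℕ} {β : Type*} [Fintype β] {p : β → ℝ}
    (hp : ∑ b, p b = 1) (g : β → ℝ) {s t : Fin n} (hst : s ≠ t) :
    ∑ ω : Fin n → β, prodP p ω * (g (ω s) * g (ω t)) = (∑ b, p b * g b) ^ 2 := by
  have h := sum_prodP_mul_prod (n := n) p fun r b =>
    (if r = s then g b else 1) * (if r = t then g b else 1)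
  have h2 : ∀ r : Fin n,
      ∑ b, p b * ((if r = s then g b else 1) * (if r = t then g b else 1)) =
      (if r = s then ∑ b, p b * g b else 1) * (if r = t then ∑ b, p b * g b else 1) := by
    intro r
    by_cases h1 : r = s
    · subst h1
      simp [hst]
    · by_cases h3 : r = t <;> simp [h1, h3, hp]
      subst h3
      simp [h1]
  simp only [h2, Finset.prod_mul_distrib] at h
  simpa [sq] using h

theorem sum_prodP_mul_sum {n : ℕ} {β : Type*} [Fintype β] {p : β → ℝ} (hp : ∑ b, p b = 1)
    (g : β → ℝ) :
    ∑ ω : Fin n → β, prodP p ω * ∑ t, g (ω t) = n * ∑ b, p b * g b := by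
  simp only [Finset.mul_sum (Finset.univ : Finset (Fin n))]
  rw [Finset.sum_comm]
  simp [sum_prodP_mul_apply hp g]

theorem sum_prodP_mul_sum_sq {n : ℕ} {β : Type*} [Fintype β] {p : β → ℝ} (hp : ∑ b, p b = 1)
    (g : β → ℝ) :
    ∑ ω : Fin n → β, prodP p ω * (∑ t, g (ω t)) ^ 2 =
      n * ∑ b, p b * g b ^ 2 + n * (n - 1) * (∑ b, p b * g b) ^ 2 := by
  have h : ∀ s t : Fin n, ∑ ω : Fin n → β, prodP p ω * (g (ω s) * g (ω t)) =
      (∑ b, p b * g b) ^ 2 +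
        if s = t then ∑ b, p b * g b ^ 2 - (∑ b, p b * g b) ^ 2 else 0 := by
    intro s t
    split_ifs with hst
    · subst hst
      rw [← sum_prodP_mul_apply hp (fun b => g b ^ 2) s]
      simp [sq]
    · simp [sum_prodP_mul_apply_mul_apply hp g hst]
  have h2 : ∀ ω : Fin n → β, prodP p ω * (∑ t, g (ω t)) ^ 2 =
      ∑ s, ∑ t, prodP p ω * (g (ω s) * g (ω t)) := by
    intro ω
    rw [sq, Finset.sum_mul_sum]
    simp only [Finset.mul_sum]
  have h3 : ∑ ω : Fin n → β, prodP p ω * (∑ t, g (ω t)) ^ 2 =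
      ∑ s, ∑ t, ∑ ω : Fin n → β, prodP p ω * (g (ω s) * g (ω t)) := by
    rw [Finset.sum_congr rfl fun ω _ => h2 ω, Finset.sum_comm]
    exact Finset.sum_congr rfl fun s _ => Finset.sum_comm
  rw [h3]
  simp only [h]
  simp only [Finset.sum_add_distrib, Finset.sum_ite_eq, Finset.mem_univ, if_true,
    Finset.sum_const, Finset.card_univ, Fintype.card_fin, nsmul_eq_mul]
  ring

theorem empDist_eq_sum {n : ℕ} {α : Type*} [Fintype α] (s : Fin n → α) (a : α) :
    empDist s a = (∑ t, if s t = a then (1 : ℝ) else 0) / n := by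
  simp [empDist]

theorem empDist_nonneg {n : ℕ} {α : Type*} [Fintype α] (s : Fin n → α) (a : α) :
    0 ≤ empDist s a := by
  unfold empDist
  positivity

theorem sum_empDist {n : ℕ} (hn : 1 ≤ n) {α : Type*} [Fintype α] (s : Fin n → α) :
    ∑ a, empDist s a = 1 := by
  have : (n : ℝ) ≠ 0 := by positivity
  simp_rw [empDist_eq_sum, ← Finset.sum_div]
  rw [Finset.sum_comm]
  simp [this]

/-- The pushforward of `p` along `f`. -/
def push {α β : Type*} [Fintype β] (p : β → ℝ) (f : β → α) (a : α) : ℝ :=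
  ∑ b, p b * if f b = a then 1 else 0

theorem expect_empDist {n : ℕ} (hn : 1 ≤ n) {α β : Type*} [Fintype α] [Fintype β] {p : β → ℝ}
    (hp : ∑ b, p b = 1) (f : β → α) (a : α) :
    ∑ ω : Fin n → β, prodP p ω * empDist (fun t => f (ω t)) a = push p f a := by
  have hn' : (n : ℝ) ≠ 0 := by positivity
  have h := sum_prodP_mul_sum (n := n) hp fun b => if f b = a then (1 : ℝ) else 0
  simp_rw [empDist_eq_sum, ← mul_div_assoc, ← Finset.sum_div]
  rw [h, push]
  field_simp

theorem expect_empDist_sq {n : ℕ} (hn : 1 ≤ n) {α β : Type*} [Fintype α] [Fintype β]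
    {p : β → ℝ} (hp : ∑ b, p b = 1) (f : β → α) (a : α) :
    ∑ ω : Fin n → β, prodP p ω * empDist (fun t => f (ω t)) a ^ 2 =
      push p f a * ((1 - push p f a) / n + push p f a) := by
  have hn' : (n : ℝ) ≠ 0 := by positivity
  have h := sum_prodP_mul_sum_sq (n := n) hp fun b => if f b = a then (1 : ℝ) else 0
  have h2 : ∀ b, (if f b = a then (1 : ℝ) else 0) ^ 2 = if f b = a then 1 else 0 := by
    intro b
    split_ifs <;> simp
  simp only [h2] at h
  simp_rw [empDist_eq_sum, div_pow, ← mul_div_assoc, ← Finset.sum_div]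
  rw [h]
  change (_ * push p f a + _ * push p f a ^ 2) / _ = _
  field_simp
  ring

theorem sum_push {α β : Type*} [Fintype α] [Fintype β] {p : β → ℝ} (hp : ∑ b, p b = 1)
    (f : β → α) : ∑ a, push p f a = 1 := by
  unfold push
  rw [Finset.sum_comm]
  simpa using hp

/-- The bias of the plug-in entropy estimator is an expected relative entropy. -/
theorem ent_sub_expect_ent {n : ℕ} (hn : 1 ≤ n) {α β : Type*} [Fintype α] [Fintype β]
    {p : β → ℝ} (hp : ∑ b, p b = 1) (f : β → α) :
    ent (push p f) - ∑ ω : Fin n → β, prodP p ω * ent (empDist fun t => f (ω t)) =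
      (∑ ω : Fin n → β, prodP p ω * ∑ a, empDist (fun t => f (ω t)) a *
        (Real.log (empDist (fun t => f (ω t)) a) - Real.log (push p f a))) / Real.log 2 := by
  have h : ent (push p f) = -(∑ ω : Fin n → β, prodP p ω *
      ∑ a, empDist (fun t => f (ω t)) a * Real.log (push p f a)) / Real.log 2 := by
    simp_rw [Finset.mul_sum]
    rw [Finset.sum_comm]
    simp_rw [← mul_assoc, ← Finset.sum_mul, expect_empDist hn hp f]
    simp only [ent, Real.logb, ← mul_div_assoc, ← Finset.sum_div, neg_div]
  rw [h]
  simp only [ent, Real.logb, ← mul_div_assoc, ← Finset.sum_div, mul_sub, Finset.sum_sub_distrib,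
    mul_neg, Finset.sum_neg_distrib]
  ring

theorem prodP_nonneg {n : ℕ} {β : Type*} [Fintype β] {p : β → ℝ} (hp : ∀ b, 0 ≤ p b)
    (ω : Fin n → β) : 0 ≤ prodP p ω :=
  Finset.prod_nonneg fun _ _ => hp _

theorem sub_le_mul_log_sub_log {x q : ℝ} (hx : 0 ≤ x) (hq : 0 < q) :
    x - q ≤ x * (Real.log x - Real.log q) := by
  rcases hx.eq_or_lt with rfl | hx
  · simpa using hq.le
  have h := Real.log_le_sub_one_of_pos (div_pos hq hx)
  rw [Real.log_div hq.ne' hx.ne'] at h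
  have h2 := mul_le_mul_of_nonneg_left h hx.le
  have h3 : x * (q / x - 1) = q - x := by field_simp
  linarith

theorem mul_log_sub_log_le {x q c : ℝ} (hx : 0 ≤ x) (hq : 0 < q) (hc : 0 < c) :
    x * (Real.log x - Real.log q) ≤ x * (Real.log c - 1) + x ^ 2 * (q⁻¹ * c⁻¹) := by
  rcases hx.eq_or_lt with rfl | hx
  · simp
  have h := Real.log_le_sub_one_of_pos (div_pos hx (mul_pos hq hc))
  rw [Real.log_div hx.ne' (mul_pos hq hc).ne', Real.log_mul hq.ne' hc.ne'] at h
  have h2 := mul_le_mul_of_nonneg_left h hx.le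
  have h3 : x * (x / (q * c) - 1) = x ^ 2 * (q⁻¹ * c⁻¹) - x := by field_simp
  linarith

theorem ent_sub_expect_ent_nonneg {n : ℕ} (hn : 1 ≤ n) {α β : Type*} [Fintype α] [Fintype β]
    {p : β → ℝ} (hp0 : ∀ b, 0 ≤ p b) (hp : ∑ b, p b = 1) (f : β → α)
    (hf : ∀ a, 0 < push p f a) :
    0 ≤ ent (push p f) - ∑ ω : Fin n → β, prodP p ω * ent (empDist fun t => f (ω t)) := by
  rw [ent_sub_expect_ent hn hp f]
  refine div_nonneg (Finset.sum_nonneg fun ω _ => mul_nonneg (prodP_nonneg hp0 ω) ?_)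
    (Real.log_nonneg one_le_two)
  have h := Finset.sum_le_sum fun a (_ : a ∈ Finset.univ) =>
    sub_le_mul_log_sub_log (empDist_nonneg (fun t => f (ω t)) a) (hf a)
  rwa [Finset.sum_sub_distrib, sum_empDist hn, sum_push hp f, sub_self] at h

theorem one_add_card_sub_one_div_pos (n : ℕ) (α : Type*) [Fintype α] [Nonempty α] :
    0 < 1 + ((Fintype.card α : ℝ) - 1) / n := by
  have h : (1 : ℝ) ≤ Fintype.card α := by exact_mod_cast Fintype.card_pos (α := α)
  have := div_nonneg (sub_nonneg.2 h) (Nat.cast_nonneg (α := ℝ) n)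
  linarith

theorem ent_sub_expect_ent_le {n : ℕ} (hn : 1 ≤ n) {α β : Type*} [Fintype α] [Fintype β]
    [Nonempty α] {p : β → ℝ} (hp0 : ∀ b, 0 ≤ p b) (hp : ∑ b, p b = 1) (f : β → α)
    (hf : ∀ a, 0 < push p f a) :
    ent (push p f) - ∑ ω : Fin n → β, prodP p ω * ent (empDist fun t => f (ω t)) ≤
      Real.logb 2 (1 + ((Fintype.card α : ℝ) - 1) / n) := by
  have hc := one_add_card_sub_one_div_pos n α
  rw [ent_sub_expect_ent hn hp f, Real.logb]
  set c : ℝ := 1 + ((Fintype.card α : ℝ) - 1) / n with hcdef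
  refine div_le_div_of_nonneg_right ?_ (Real.log_nonneg one_le_two)
  calc
    _ ≤ ∑ ω : Fin n → β, prodP p ω * ∑ a, (empDist (fun t => f (ω t)) a * (Real.log c - 1) +
          empDist (fun t => f (ω t)) a ^ 2 * ((push p f a)⁻¹ * c⁻¹)) := by
      refine Finset.sum_le_sum fun ω _ => mul_le_mul_of_nonneg_left ?_ (prodP_nonneg hp0 ω)
      exact Finset.sum_le_sum fun a _ => mul_log_sub_log_le (empDist_nonneg _ a) (hf a) hc
    _ = (Real.log c - 1) + ∑ a, ((1 - push p f a) / n + push p f a) * c⁻¹ := by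
      simp_rw [Finset.sum_add_distrib, ← Finset.sum_mul, sum_empDist hn, mul_add,
        Finset.sum_add_distrib, one_mul, ← Finset.sum_mul, sum_prodP hp, one_mul, Finset.mul_sum]
      rw [Finset.sum_comm]
      simp_rw [← mul_assoc, ← Finset.sum_mul, expect_empDist_sq hn hp f]
      congr 2
      rw [← Finset.sum_add_distrib]
      refine Finset.sum_congr rfl fun a _ => ?_
      have := (hf a).ne'
      field_simp
    _ = Real.log c := by
      rw [← Finset.sum_mul, Finset.sum_add_distrib, ← Finset.sum_div, Finset.sum_sub_distrib,
        sum_push hp f]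
      have h : (∑ _a : α, (1 : ℝ) - 1) / n + 1 = c := by
        simp [hcdef, add_comm]
      rw [h, mul_inv_cancel₀ hc.ne']
      ring

theorem push_id {β : Type*} [Fintype β] (p : β → ℝ) : push p (fun b => b) = p := by
  ext a
  simp [push]

theorem push_fst {𝒳 𝒴 : Type*} [Fintype 𝒳] [Fintype 𝒴] (p : 𝒳 × 𝒴 → ℝ) :
    push p Prod.fst = fun a => ∑ b, p (a, b) := by
  ext a
  rw [push, Fintype.sum_prod_type, Finset.sum_comm]
  simp

theorem push_snd {𝒳 𝒴 : Type*} [Fintype 𝒳] [Fintype 𝒴] (p : 𝒳 × 𝒴 → ℝ) :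
    push p Prod.snd = fun b => ∑ a, p (a, b) := by
  ext b
  rw [push, Fintype.sum_prod_type]
  simp

/-- bias of the EMI estimator. For n i.i.d. samples from a full-support
pmf on 𝒳 × 𝒴,
−log((1+(|𝒳|−1)/n)(1+(|𝒴|−1)/n)) ≤ E[I_EMI^{(n)}] − I(X ∧ Y) ≤ log(1+(|𝒳||𝒴|−1)/n). -/
theorem emi_bias {𝒳 𝒴 : Type*} [Fintype 𝒳] [Fintype 𝒴] {n : ℕ} (hn : 1 ≤ n)
    (p : 𝒳 × 𝒴 → ℝ) (hp0 : ∀ ab, 0 < p ab) (hp1 : ∑ ab, p ab = 1) :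
    -Real.logb 2 ((1 + ((Fintype.card 𝒳 : ℝ) - 1) / n) * (1 + ((Fintype.card 𝒴 : ℝ) - 1) / n))
        ≤ expect (prodP p) (fun ω : Fin n → 𝒳 × 𝒴 => emi ω) - miDist p
      ∧
    expect (prodP p) (fun ω : Fin n → 𝒳 × 𝒴 => emi ω) - miDist p
        ≤ Real.logb 2 (1 + ((Fintype.card 𝒳 : ℝ) * (Fintype.card 𝒴 : ℝ) - 1) / n) := by
  have hne : Nonempty (𝒳 × 𝒴) := by
    by_contra h
    rw [not_nonempty_iff] at h
    simp at hp1
  have : Nonempty 𝒳 := hne.map Prod.fst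
  have : Nonempty 𝒴 := hne.map Prod.snd
  have hp0' : ∀ ab, 0 ≤ p ab := fun ab => (hp0 ab).le
  have hX : ∀ a, 0 < push p Prod.fst a := fun a => by
    rw [push_fst]
    exact Finset.sum_pos (fun b _ => hp0 (a, b)) Finset.univ_nonempty
  have hY : ∀ b, 0 < push p Prod.snd b := fun b => by
    rw [push_snd]
    exact Finset.sum_pos (fun a _ => hp0 (a, b)) Finset.univ_nonempty
  have hXY : ∀ ab, 0 < push p (fun ab => ab) ab := fun ab => by
    rw [push_id]
    exact hp0 ab
  have hx := ent_sub_expect_ent_nonneg hn hp0' hp1 Prod.fst hX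
  have hy := ent_sub_expect_ent_nonneg hn hp0' hp1 Prod.snd hY
  have hxy := ent_sub_expect_ent_nonneg hn hp0' hp1 (fun ab => ab) hXY
  have hx' := ent_sub_expect_ent_le hn hp0' hp1 Prod.fst hX
  have hy' := ent_sub_expect_ent_le hn hp0' hp1 Prod.snd hY
  have hxy' := ent_sub_expect_ent_le hn hp0' hp1 (fun ab => ab) hXY
  rw [push_fst] at hx hx'
  rw [push_snd] at hy hy'
  rw [push_id] at hxy hxy'
  rw [Fintype.card_prod, Nat.cast_mul] at hxy'
  rw [Real.logb_mul (one_add_card_sub_one_div_pos n 𝒳).ne'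
    (one_add_card_sub_one_div_pos n 𝒴).ne']
  simp only [expect, emi, miDist, mul_add, mul_sub, Finset.sum_add_distrib,
    Finset.sum_sub_distrib]
  constructor <;> linarith

end EMI
end
end
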